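/- Let λ, μ ∈ (0,∞) and t > 0. If (u_n), (h_n) are sequences of graphons and u, h are graphons with δ_□(u_n, u) → 0 and δ_□(h_n, h) → 0, then liminf_{n→∞} Ĩ_{1,t}(u_n, h_n) ≥ Ĩ_{1,t}(u, h). In particular Ĩ_{1,t} is lower semi-continuous with respect to the cut metric in both arguments. -/

import Mathlib

noncomputable section

open MeasureTheory Real Filter

/-- Probability that an initially inactive edge is active at time `t`. -/
def p01 (lam mu t : ℝ) : ℝ := (lam - lam * Real.exp (-(t * (lam + mu)))) / (lam + mu)

/-- Probability that an initially active edge is active at time `t`. -/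
def p11 (lam mu t : ℝ) : ℝ := (lam + mu * Real.exp (-(t * (lam + mu)))) / (lam + mu)

/-- The cumulant-type function `J_{t,v}(u)`. -/
def Jfun (lam mu t v u : ℝ) : ℝ :=
  u * Real.log (1 - p11 lam mu t + Real.exp v * p11 lam mu t) +
  (1 - u) * Real.log (1 - p01 lam mu t + Real.exp v * p01 lam mu t)

/-- The one-step rate function `I_{1,t}(u,x) = sup_v [v x - J_{t,v}(u)]`. -/
def I1 (lam mu t u x : ℝ) : ℝ := ⨆ v : ℝ, (v * x - Jfun lam mu t v u)

/-- A graphon: a measurable symmetric function with values in `[0,1]`. -/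
def IsGraphon (f : ℝ → ℝ → ℝ) : Prop :=
  Measurable (Function.uncurry f) ∧ (∀ x y, f x y ∈ Set.Icc (0:ℝ) 1) ∧ ∀ x y, f x y = f y x

/-- The unit square `[0,1]²`. -/
def unitSq : Set (ℝ × ℝ) := Set.Icc (0:ℝ) 1 ×ˢ Set.Icc (0:ℝ) 1

/-- The cut distance between two (bounded measurable) kernels on `[0,1]²`. -/
def cutDist (f g : ℝ → ℝ → ℝ) : ℝ :=
  ⨆ S : {S : Set ℝ // MeasurableSet S ∧ S ⊆ Set.Icc (0:ℝ) 1},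
    ⨆ T : {T : Set ℝ // MeasurableSet T ∧ T ⊆ Set.Icc (0:ℝ) 1},
      |∫ p in S.1 ×ˢ T.1, (f p.1 p.2 - g p.1 p.2)|

/-- A measure-preserving bijection of `[0,1]` (measure preserving in both directions). -/
def IsMPB (σ : ℝ → ℝ) : Prop :=
  Measurable σ ∧ Set.BijOn σ (Set.Icc (0:ℝ) 1) (Set.Icc (0:ℝ) 1) ∧
  ∀ A : Set ℝ, MeasurableSet A → A ⊆ Set.Icc (0:ℝ) 1 →
    volume (σ ⁻¹' A ∩ Set.Icc (0:ℝ) 1) = volume A ∧ volume (σ '' A) = volume A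

/-- The relabelling `h^σ` of a kernel by a map `σ`. -/
def perm (σ : ℝ → ℝ) (h : ℝ → ℝ → ℝ) : ℝ → ℝ → ℝ := fun x y => h (σ x) (σ y)

/-- The cut metric `δ_□`. -/
def cutMetric (f g : ℝ → ℝ → ℝ) : ℝ :=
  ⨅ σ₁ : {σ : ℝ → ℝ // IsMPB σ}, ⨅ σ₂ : {σ : ℝ → ℝ // IsMPB σ},
    cutDist (perm σ₁.1 f) (perm σ₂.1 g)

/-- The rate functional `I_{1,t}(u,h)` for kernels `u, h`. -/
def I1W (lam mu t : ℝ) (u h : ℝ → ℝ → ℝ) : ℝ :=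
  ∫ p in unitSq, I1 lam mu t (u p.1 p.2) (h p.1 p.2)

/-- The rate functional `Ĩ_{1,t}(u,h) = inf_σ I_{1,t}(u, h^σ)`. -/
def I1tilde (lam mu t : ℝ) (u h : ℝ → ℝ → ℝ) : ℝ :=
  ⨅ σ : {σ : ℝ → ℝ // IsMPB σ}, I1W lam mu t u (perm σ.1 h)

/-! ### Helper lemmas on the one-step rate function -/

def GG (p v : ℝ) : ℝ := Real.log (1 - p + Real.exp v * p)

lemma p01_mem (lam mu t : ℝ) (hlam : 0 < lam) (hmu : 0 < mu) (ht : 0 < t) :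
    0 < p01 lam mu t ∧ p01 lam mu t < 1 := by
  have h1 : Real.exp (-(t * (lam + mu))) < 1 := by
    rw [Real.exp_lt_one_iff]; nlinarith [mul_pos ht (add_pos hlam hmu)]
  have h2 := Real.exp_pos (-(t * (lam + mu)))
  unfold p01
  constructor
  · apply div_pos _ (by linarith)
    nlinarith
  · rw [div_lt_one (by linarith)]
    nlinarith

lemma p11_mem (lam mu t : ℝ) (hlam : 0 < lam) (hmu : 0 < mu) (ht : 0 < t) :
    0 < p11 lam mu t ∧ p11 lam mu t < 1 := by
  have h1 : Real.exp (-(t * (lam + mu))) < 1 := by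
    rw [Real.exp_lt_one_iff]; nlinarith [mul_pos ht (add_pos hlam hmu)]
  have h2 := Real.exp_pos (-(t * (lam + mu)))
  unfold p11
  constructor
  · apply div_pos _ (by linarith)
    nlinarith
  · rw [div_lt_one (by linarith)]
    nlinarith

lemma GG_arg_pos {p : ℝ} (hp : 0 < p ∧ p < 1) (v : ℝ) : 0 < 1 - p + Real.exp v * p := by
  have := mul_pos (Real.exp_pos v) hp.1
  linarith [hp.2]

lemma GG_continuous {p : ℝ} (hp : 0 < p ∧ p < 1) : Continuous (GG p) := by
  unfold GG
  exact Continuous.log (by fun_prop) (fun v => (GG_arg_pos hp v).ne')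

lemma GG_abs {p : ℝ} (hp : 0 < p ∧ p < 1) (v : ℝ) : |GG p v| ≤ |v| := by
  unfold GG
  rcases le_total 0 v with hv | hv
  · have h1 : 1 ≤ Real.exp v := Real.one_le_exp hv
    have h2 : 0 ≤ Real.log (1 - p + Real.exp v * p) := Real.log_nonneg (by nlinarith [hp.1])
    rw [abs_of_nonneg hv, abs_of_nonneg h2, Real.log_le_iff_le_exp (GG_arg_pos hp v)]
    nlinarith [hp.2]
  · have h1 : Real.exp v ≤ 1 := Real.exp_le_one_iff.2 hv
    have h2 : Real.log (1 - p + Real.exp v * p) ≤ 0 :=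
      Real.log_nonpos (GG_arg_pos hp v).le (by nlinarith [hp.1])
    rw [abs_of_nonpos hv, abs_of_nonpos h2]
    apply neg_le_neg
    rw [Real.le_log_iff_exp_le (GG_arg_pos hp v)]
    nlinarith [hp.2]

lemma GG_far {p : ℝ} (hp : 0 < p ∧ p < 1) {ε : ℝ} (hε : 0 < ε) :
    ∀ᶠ M : ℝ in atTop, (∀ v, M ≤ v → GG p M - M ≤ GG p v - v + ε) ∧
      (∀ v, v ≤ -M → GG p (-M) ≤ GG p v + ε) := by
  have hp1 : 0 < 1 - p := by linarith [hp.2]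
  have e1 : Tendsto (fun M : ℝ => Real.exp (-M)) atTop (nhds 0) := Real.tendsto_exp_neg_atTop_nhds_zero
  have hA : Tendsto (fun M : ℝ => Real.log ((1 - p) * Real.exp (-M) + p)) atTop
      (nhds (Real.log p)) := by
    have : Tendsto (fun M : ℝ => (1 - p) * Real.exp (-M) + p) atTop (nhds p) := by
      simpa using (e1.const_mul (1 - p)).add_const p
    exact this.log hp.1.ne'
  have hB : Tendsto (fun M : ℝ => GG p (-M)) atTop (nhds (Real.log (1 - p))) := by
    have : Tendsto (fun M : ℝ => 1 - p + Real.exp (-M) * p) atTop (nhds (1 - p)) := by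
      simpa using (e1.mul_const p).const_add (1 - p)
    exact this.log hp1.ne'
  have key : ∀ v : ℝ, GG p v - v = Real.log ((1 - p) * Real.exp (-v) + p) := by
    intro v
    have : 1 - p + Real.exp v * p = ((1 - p) * Real.exp (-v) + p) * Real.exp v := by
      have : Real.exp (-v) * Real.exp v = 1 := by rw [← Real.exp_add]; simp
      linear_combination (-(1 - p)) * this
    have h3 : 0 < (1 - p) * Real.exp (-v) + p := by
      have := mul_pos hp1 (Real.exp_pos (-v)); linarith [hp.1]
    unfold GG
    rw [this, Real.log_mul h3.ne' (Real.exp_pos v).ne', Real.log_exp]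
    ring
  filter_upwards [hA.eventually_lt_const (show Real.log p < Real.log p + ε by linarith),
    hB.eventually_lt_const (show Real.log (1 - p) < Real.log (1 - p) + ε by linarith)] with M h1 h2
  constructor
  · intro v _
    rw [key, key]
    have : Real.log p ≤ Real.log ((1 - p) * Real.exp (-v) + p) :=
      Real.log_le_log hp.1 (by have := mul_pos hp1 (Real.exp_pos (-v)); linarith)
    linarith
  · intro v _
    have : Real.log (1 - p) ≤ GG p v :=
      Real.log_le_log hp1 (by have := mul_pos (Real.exp_pos v) hp.1; linarith)
    linarith

lemma Jfun_eq (lam mu t v u : ℝ) : Jfun lam mu t v u =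
    u * GG (p11 lam mu t) v + (1 - u) * GG (p01 lam mu t) v := rfl

/-- Slope of `J` in `u`. -/
def Jslope (lam mu t v : ℝ) : ℝ := GG (p11 lam mu t) v - GG (p01 lam mu t) v

lemma Jfun_sub (lam mu t v a b : ℝ) :
    Jfun lam mu t v a - Jfun lam mu t v b = Jslope lam mu t v * (a - b) := by
  rw [Jfun_eq, Jfun_eq, Jslope]; ring

section rate
variable {lam mu t : ℝ} (hlam : 0 < lam) (hmu : 0 < mu) (ht : 0 < t)

lemma Jslope_abs (lam mu t : ℝ) (hlam : 0 < lam) (hmu : 0 < mu) (ht : 0 < t)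
    {v M : ℝ} (hv : |v| ≤ M) : |Jslope lam mu t v| ≤ 2 * M := by
  have h1 := GG_abs (p11_mem lam mu t hlam hmu ht) v
  have h2 := GG_abs (p01_mem lam mu t hlam hmu ht) v
  unfold Jslope
  have := abs_sub (GG (p11 lam mu t) v) (GG (p01 lam mu t) v)
  linarith

lemma near_opt (lam mu t : ℝ) (hlam : 0 < lam) (hmu : 0 < mu) (ht : 0 < t)
    {ε : ℝ} (hε : 0 < ε) :
    ∃ M : ℝ, 0 < M ∧ ∀ a ∈ Set.Icc (0:ℝ) 1, ∀ x ∈ Set.Icc (0:ℝ) 1, ∀ v : ℝ,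
      ∃ w : ℝ, |w| ≤ M ∧ v * x - Jfun lam mu t v a ≤ w * x - Jfun lam mu t w a + ε := by
  obtain ⟨M, ⟨h1, h2⟩, ⟨h3, h4⟩, hM⟩ := ((GG_far (p11_mem lam mu t hlam hmu ht) hε).and
    ((GG_far (p01_mem lam mu t hlam hmu ht) hε).and (eventually_gt_atTop (0:ℝ)))).exists
  refine ⟨M, hM, fun a ha x hx v => ?_⟩
  rcases le_total M v with hv | hv
  · refine ⟨M, (abs_of_pos hM).le, ?_⟩
    have k1 := mul_le_mul_of_nonneg_left (h1 v hv) ha.1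
    have k2 := mul_le_mul_of_nonneg_left (h3 v hv) (sub_nonneg.2 ha.2)
    have k3 := mul_le_mul_of_nonneg_left hv (sub_nonneg.2 hx.2)
    rw [Jfun_eq, Jfun_eq]
    nlinarith
  · rcases le_total v (-M) with hv' | hv'
    · refine ⟨-M, by rw [abs_neg, abs_of_pos hM], ?_⟩
      have k1 := mul_le_mul_of_nonneg_left (h2 v hv') ha.1
      have k2 := mul_le_mul_of_nonneg_left (h4 v hv') (sub_nonneg.2 ha.2)
      have k3 := mul_le_mul_of_nonneg_left hv' hx.1
      rw [Jfun_eq, Jfun_eq]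
      nlinarith
    · exact ⟨v, abs_le.2 ⟨hv', hv⟩, by linarith⟩

lemma term_bound (lam mu t : ℝ) (hlam : 0 < lam) (hmu : 0 < mu) (ht : 0 < t)
    {M w a x : ℝ} (hw : |w| ≤ M) (ha : a ∈ Set.Icc (0:ℝ) 1) (hx : x ∈ Set.Icc (0:ℝ) 1) :
    w * x - Jfun lam mu t w a ≤ 2 * M := by
  have h1 := abs_le.1 ((GG_abs (p11_mem lam mu t hlam hmu ht) w).trans hw)
  have h2 := abs_le.1 ((GG_abs (p01_mem lam mu t hlam hmu ht) w).trans hw)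
  have h3 := abs_le.1 hw
  have k1 := mul_le_mul_of_nonneg_left h1.1 ha.1
  have k2 := mul_le_mul_of_nonneg_left h2.1 (sub_nonneg.2 ha.2)
  have k3 := mul_le_mul_of_nonneg_left h3.2 hx.1
  have hM : 0 ≤ M := (abs_nonneg w).trans hw
  have k4 := mul_le_mul_of_nonneg_left hx.2 hM
  rw [Jfun_eq]
  nlinarith

lemma I1_bdd (lam mu t : ℝ) (hlam : 0 < lam) (hmu : 0 < mu) (ht : 0 < t) :
    ∃ B : ℝ, ∀ a ∈ Set.Icc (0:ℝ) 1, ∀ x ∈ Set.Icc (0:ℝ) 1, ∀ v : ℝ,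
      v * x - Jfun lam mu t v a ≤ B := by
  obtain ⟨M, _, h⟩ := near_opt lam mu t hlam hmu ht one_pos
  refine ⟨2 * M + 1, fun a ha x hx v => ?_⟩
  obtain ⟨w, hw, h2⟩ := h a ha x hx v
  linarith [term_bound lam mu t hlam hmu ht hw ha hx]

lemma I1_bddAbove (lam mu t : ℝ) (hlam : 0 < lam) (hmu : 0 < mu) (ht : 0 < t)
    {a x : ℝ} (ha : a ∈ Set.Icc (0:ℝ) 1) (hx : x ∈ Set.Icc (0:ℝ) 1) :
    BddAbove (Set.range fun v : ℝ => v * x - Jfun lam mu t v a) := by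
  obtain ⟨B, hB⟩ := I1_bdd lam mu t hlam hmu ht
  exact ⟨B, by rintro _ ⟨v, rfl⟩; exact hB a ha x hx v⟩

lemma le_I1 (lam mu t : ℝ) (hlam : 0 < lam) (hmu : 0 < mu) (ht : 0 < t)
    {a x : ℝ} (ha : a ∈ Set.Icc (0:ℝ) 1) (hx : x ∈ Set.Icc (0:ℝ) 1) (v : ℝ) :
    v * x - Jfun lam mu t v a ≤ I1 lam mu t a x :=
  le_ciSup (I1_bddAbove lam mu t hlam hmu ht ha hx) v

lemma I1_nonneg (lam mu t : ℝ) (hlam : 0 < lam) (hmu : 0 < mu) (ht : 0 < t)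
    {a x : ℝ} (ha : a ∈ Set.Icc (0:ℝ) 1) (hx : x ∈ Set.Icc (0:ℝ) 1) :
    0 ≤ I1 lam mu t a x := by
  have := le_I1 lam mu t hlam hmu ht ha hx 0
  simpa [Jfun] using this

lemma I1_measurable (lam mu t : ℝ) (hlam : 0 < lam) (hmu : 0 < mu) (ht : 0 < t)
    {f g : ℝ × ℝ → ℝ} (hf : Measurable f) (hg : Measurable g)
    (hf1 : ∀ p, f p ∈ Set.Icc (0:ℝ) 1) (hg1 : ∀ p, g p ∈ Set.Icc (0:ℝ) 1) :
    Measurable (fun p => I1 lam mu t (f p) (g p)) := by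
  apply measurable_of_Ioi
  intro c
  have : (fun p => I1 lam mu t (f p) (g p)) ⁻¹' Set.Ioi c =
      ⋃ q : ℚ, {p | c < (q:ℝ) * g p - Jfun lam mu t q (f p)} := by
    ext p
    simp only [Set.mem_preimage, Set.mem_Ioi, Set.mem_iUnion, Set.mem_ofPred_eq]
    unfold I1
    rw [lt_ciSup_iff (I1_bddAbove lam mu t hlam hmu ht (hf1 p) (hg1 p))]
    constructor
    · rintro ⟨v, hv⟩
      have hc : Continuous (fun v : ℝ => v * g p - Jfun lam mu t v (f p)) := by
        simp only [Jfun_eq]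
        have c1 := GG_continuous (p11_mem lam mu t hlam hmu ht)
        have c2 := GG_continuous (p01_mem lam mu t hlam hmu ht)
        fun_prop
      obtain ⟨q, hq⟩ := Rat.denseRange_cast.exists_mem_open
        (isOpen_lt continuous_const hc) ⟨v, hv⟩
      exact ⟨q, hq⟩
    · rintro ⟨q, hq⟩; exact ⟨q, hq⟩
  rw [this]
  refine MeasurableSet.iUnion fun q => measurableSet_lt measurable_const ?_
  simp only [Jfun_eq]
  fun_prop

end rate

/-! ### Measure-preserving bijections -/

lemma IsMPB.id_mem : IsMPB (fun x : ℝ => x) := by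
  refine ⟨measurable_id, Set.bijOn_id _, fun A _ hA1 => ⟨?_, ?_⟩⟩
  · congr 1
    exact Set.inter_eq_left.2 hA1
  · simp

lemma IsMPB.comp {σ τ : ℝ → ℝ} (hσ : IsMPB σ) (hτ : IsMPB τ) : IsMPB (fun x => σ (τ x)) := by
  obtain ⟨s1, s2, s3⟩ := hσ
  obtain ⟨t1, t2, t3⟩ := hτ
  refine ⟨s1.comp t1, s2.comp t2, fun A hA hA1 => ⟨?_, ?_⟩⟩
  · rw [← (s3 A hA hA1).1,
      ← (t3 (σ ⁻¹' A ∩ Set.Icc (0:ℝ) 1) ((s1 hA).inter measurableSet_Icc) Set.inter_subset_right).1]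
    congr 1
    ext x
    simp only [Set.mem_inter_iff, Set.mem_preimage]
    constructor
    · rintro ⟨h1, h2⟩; exact ⟨⟨h1, t2.mapsTo h2⟩, h2⟩
    · rintro ⟨⟨h1, _⟩, h2⟩; exact ⟨h1, h2⟩
  · have : (fun x => σ (τ x)) '' A = σ '' (τ '' A) := by rw [Set.image_image]
    rw [this, (s3 (τ '' A) (hA.image_of_measurable_injOn t1 (t2.injOn.mono hA1))
      ((Set.image_mono hA1).trans t2.mapsTo.image_subset)).2, (t3 A hA hA1).2]

lemma IsMPB.exists_inv {σ : ℝ → ℝ} (hσ : IsMPB σ) : ∃ τ : ℝ → ℝ, IsMPB τ ∧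
    (∀ x ∈ Set.Icc (0:ℝ) 1, σ (τ x) = x) ∧ (∀ x ∈ Set.Icc (0:ℝ) 1, τ (σ x) = x) := by
  classical
  obtain ⟨s1, s2, s3⟩ := hσ
  let τ : ℝ → ℝ := fun x => if x ∈ Set.Icc (0:ℝ) 1 then Function.invFunOn σ (Set.Icc (0:ℝ) 1) x else x
  have hτ : ∀ x ∈ Set.Icc (0:ℝ) 1, τ x = Function.invFunOn σ (Set.Icc (0:ℝ) 1) x :=
    fun x hx => if_pos hx
  have hinv := s2.invOn_invFunOn
  have h1 : ∀ x ∈ Set.Icc (0:ℝ) 1, σ (τ x) = x := fun x hx => by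
    rw [hτ x hx]; exact hinv.2 hx
  have h2 : ∀ x ∈ Set.Icc (0:ℝ) 1, τ (σ x) = x := fun x hx => by
    rw [hτ _ (s2.mapsTo hx)]; exact hinv.1 hx
  have hm : ∀ x ∈ Set.Icc (0:ℝ) 1, τ x ∈ Set.Icc (0:ℝ) 1 := fun x hx => by
    obtain ⟨y, hy, rfl⟩ := s2.surjOn hx
    rw [h2 y hy]; exact hy
  have hpre : ∀ A : Set ℝ, τ ⁻¹' A ∩ Set.Icc (0:ℝ) 1 = σ '' (A ∩ Set.Icc (0:ℝ) 1) := by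
    intro A
    ext x
    constructor
    · rintro ⟨ha, hx⟩; exact ⟨τ x, ⟨ha, hm x hx⟩, h1 x hx⟩
    · rintro ⟨y, ⟨ha, hy⟩, rfl⟩
      refine ⟨?_, s2.mapsTo hy⟩
      rw [Set.mem_preimage, h2 y hy]; exact ha
  have himg : ∀ A : Set ℝ, MeasurableSet A → MeasurableSet (σ '' (A ∩ Set.Icc (0:ℝ) 1)) :=
    fun A hA => (hA.inter measurableSet_Icc).image_of_measurable_injOn s1
      (s2.injOn.mono Set.inter_subset_right)
  refine ⟨τ, ⟨?_, ⟨hm, ?_, ?_⟩, ?_⟩, h1, h2⟩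
  · intro A hA
    have : τ ⁻¹' A = σ '' (A ∩ Set.Icc (0:ℝ) 1) ∪ (A \ Set.Icc (0:ℝ) 1) := by
      rw [← hpre]
      ext x
      by_cases hx : x ∈ Set.Icc (0:ℝ) 1
      · simp [hx]
      · have : τ x = x := if_neg hx
        simp only [Set.mem_union, Set.mem_inter_iff, Set.mem_preimage, Set.mem_sdiff, hx, this]
        tauto
    rw [this]
    exact (himg A hA).union (hA.diff measurableSet_Icc)
  · intro x hx y hy hxy
    rw [← h1 x hx, ← h1 y hy, hxy]
  · intro x hx
    exact ⟨σ x, s2.mapsTo hx, h2 x hx⟩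
  · intro A hA hA1
    constructor
    · rw [hpre, Set.inter_eq_left.2 hA1, (s3 A hA hA1).2]
    · rw [← (s3 A hA hA1).1]
      congr 1
      ext x
      constructor
      · rintro ⟨y, hy, rfl⟩
        refine ⟨?_, hm y (hA1 hy)⟩
        rw [Set.mem_preimage, h1 y (hA1 hy)]; exact hy
      · rintro ⟨ha, hx⟩
        exact ⟨σ x, ha, h2 x hx⟩

lemma IsMPB.measurePreserving {σ : ℝ → ℝ} (hσ : IsMPB σ) :
    MeasurePreserving σ (volume.restrict (Set.Icc (0:ℝ) 1)) (volume.restrict (Set.Icc (0:ℝ) 1)) := by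
  obtain ⟨s1, s2, s3⟩ := hσ
  refine ⟨s1, ?_⟩
  ext A hA
  rw [Measure.map_apply s1 hA, Measure.restrict_apply (s1 hA), Measure.restrict_apply hA,
    ← (s3 (A ∩ Set.Icc (0:ℝ) 1) (hA.inter measurableSet_Icc) Set.inter_subset_right).1]
  congr 1
  ext x
  simp only [Set.mem_inter_iff, Set.mem_preimage]
  constructor
  · rintro ⟨h1, h2⟩; exact ⟨⟨h1, s2.mapsTo h2⟩, h2⟩
  · rintro ⟨⟨h1, _⟩, h2⟩; exact ⟨h1, h2⟩

lemma restrict_unitSq : (volume : Measure (ℝ × ℝ)).restrict unitSq =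
    (volume.restrict (Set.Icc (0:ℝ) 1)).prod (volume.restrict (Set.Icc (0:ℝ) 1)) := by
  rw [unitSq, Measure.volume_eq_prod, Measure.prod_restrict]

instance unitSq_prob : IsProbabilityMeasure ((volume : Measure (ℝ × ℝ)).restrict unitSq) := by
  have : IsProbabilityMeasure ((volume : Measure ℝ).restrict (Set.Icc (0:ℝ) 1)) :=
    ⟨by simp⟩
  rw [restrict_unitSq]
  infer_instance

lemma measurableSet_unitSq : MeasurableSet unitSq := measurableSet_Icc.prod measurableSet_Icc

lemma integral_perm {σ : ℝ → ℝ} (hσ : IsMPB σ) {F : ℝ × ℝ → ℝ} (hF : Measurable F) :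
    ∫ p in unitSq, F (σ p.1, σ p.2) = ∫ p in unitSq, F p := by
  have h := hσ.measurePreserving.prod hσ.measurePreserving
  rw [← restrict_unitSq] at h
  conv_rhs => rw [← h.map_eq]
  rw [integral_map h.measurable.aemeasurable hF.aestronglyMeasurable]
  rfl

/-- All cut integrals of `f - g` are at most `d`. -/
def CutLe (f g : ℝ → ℝ → ℝ) (d : ℝ) : Prop :=
  ∀ S T : Set ℝ, MeasurableSet S → S ⊆ Set.Icc (0:ℝ) 1 → MeasurableSet T → T ⊆ Set.Icc (0:ℝ) 1 →
    |∫ p in S ×ˢ T, (f p.1 p.2 - g p.1 p.2)| ≤ d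

lemma IsGraphon.perm {f : ℝ → ℝ → ℝ} (hf : IsGraphon f) {σ : ℝ → ℝ} (hσ : IsMPB σ) :
    IsGraphon (perm σ f) := by
  obtain ⟨h1, h2, h3⟩ := hf
  refine ⟨?_, fun x y => h2 _ _, fun x y => h3 _ _⟩
  exact h1.comp ((hσ.1.comp measurable_fst).prodMk (hσ.1.comp measurable_snd))

lemma IsGraphon.meas {f : ℝ → ℝ → ℝ} (hf : IsGraphon f) :
    Measurable (fun p : ℝ × ℝ => f p.1 p.2) := hf.1

lemma setIntegral_unitSq {S T : Set ℝ} (hS : MeasurableSet S) (hS1 : S ⊆ Set.Icc (0:ℝ) 1)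
    (hT : MeasurableSet T) (hT1 : T ⊆ Set.Icc (0:ℝ) 1) (F : ℝ × ℝ → ℝ) :
    ∫ p in S ×ˢ T, F p = ∫ p in unitSq, (S ×ˢ T).indicator F p := by
  rw [setIntegral_indicator (hS.prod hT), Set.inter_eq_right.2]
  exact Set.prod_mono hS1 hT1

lemma CutLe.perm {f g : ℝ → ℝ → ℝ} {d : ℝ} (hf : IsGraphon f) (hg : IsGraphon g)
    (h : CutLe f g d) {σ : ℝ → ℝ} (hσ : IsMPB σ) : CutLe (perm σ f) (perm σ g) d := by
  intro S T hS hS1 hT hT1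
  have hi : ∀ A : Set ℝ, MeasurableSet A → A ⊆ Set.Icc (0:ℝ) 1 →
      MeasurableSet (σ '' A) ∧ σ '' A ⊆ Set.Icc (0:ℝ) 1 ∧
      ∀ x ∈ Set.Icc (0:ℝ) 1, (σ x ∈ σ '' A ↔ x ∈ A) := by
    intro A hA hA1
    refine ⟨hA.image_of_measurable_injOn hσ.1 (hσ.2.1.injOn.mono hA1),
      (Set.image_mono hA1).trans hσ.2.1.mapsTo.image_subset, fun x hx => ?_⟩
    exact hσ.2.1.injOn.mem_image_iff hA1 hx
  obtain ⟨a1, a2, a3⟩ := hi S hS hS1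
  obtain ⟨b1, b2, b3⟩ := hi T hT hT1
  have key : ∫ p in S ×ˢ T, (_root_.perm σ f p.1 p.2 - _root_.perm σ g p.1 p.2) =
      ∫ p in (σ '' S) ×ˢ (σ '' T), (f p.1 p.2 - g p.1 p.2) := by
    rw [setIntegral_unitSq hS hS1 hT hT1, setIntegral_unitSq a1 a2 b1 b2,
      ← integral_perm hσ (Measurable.indicator (f := fun p : ℝ × ℝ => f p.1 p.2 - g p.1 p.2)
        (hf.meas.sub hg.meas) (a1.prod b1))]
    refine setIntegral_congr_fun measurableSet_unitSq ?_
    rintro ⟨x, y⟩ ⟨hx, hy⟩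
    have hiff : (σ x, σ y) ∈ (σ '' S) ×ˢ (σ '' T) ↔ (x, y) ∈ S ×ˢ T := by
      rw [Set.mem_prod, Set.mem_prod]
      exact and_congr (a3 x hx) (b3 y hy)
    by_cases hxy : (x, y) ∈ S ×ˢ T
    · simp only [Set.indicator_of_mem hxy, Set.indicator_of_mem (hiff.2 hxy)]
      rfl
    · have hxy' := fun h0 => hxy (hiff.1 h0)
      simp only [Set.indicator_of_notMem hxy, Set.indicator_of_notMem hxy']
  rw [key]
  exact h _ _ a1 a2 b1 b2

lemma graphon_diff_abs {f g : ℝ → ℝ → ℝ} (hf : IsGraphon f) (hg : IsGraphon g) (x y : ℝ) :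
    |f x y - g x y| ≤ 1 := by
  have h1 := hf.2.1 x y
  have h2 := hg.2.1 x y
  rw [abs_le]; constructor <;> linarith [h1.1, h1.2, h2.1, h2.2]

lemma CutLe.of_cutDist {f g : ℝ → ℝ → ℝ} (hf : IsGraphon f) (hg : IsGraphon g) :
    CutLe f g (cutDist f g) := by
  have hb : ∀ S T : Set ℝ, MeasurableSet S → S ⊆ Set.Icc (0:ℝ) 1 → MeasurableSet T →
      T ⊆ Set.Icc (0:ℝ) 1 → |∫ p in S ×ˢ T, (f p.1 p.2 - g p.1 p.2)| ≤ 1 := by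
    intro S T hS hS1 hT hT1
    rw [setIntegral_unitSq hS hS1 hT hT1]
    have := norm_integral_le_of_norm_le_const (μ := (volume : Measure (ℝ × ℝ)).restrict unitSq)
      (f := (S ×ˢ T).indicator (fun p : ℝ × ℝ => f p.1 p.2 - g p.1 p.2)) (C := 1)
      (Eventually.of_forall fun p => by
        refine (norm_indicator_le_norm_self _ _).trans ?_
        exact graphon_diff_abs hf hg _ _)
    simpa using this
  intro S T hS hS1 hT hT1
  have hT' : ∀ S : {S : Set ℝ // MeasurableSet S ∧ S ⊆ Set.Icc (0:ℝ) 1},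
      BddAbove (Set.range fun T : {T : Set ℝ // MeasurableSet T ∧ T ⊆ Set.Icc (0:ℝ) 1} =>
        |∫ p in S.1 ×ˢ T.1, (f p.1 p.2 - g p.1 p.2)|) := fun S =>
    ⟨1, by rintro _ ⟨T, rfl⟩; exact hb _ _ S.2.1 S.2.2 T.2.1 T.2.2⟩
  have hne : Nonempty {T : Set ℝ // MeasurableSet T ∧ T ⊆ Set.Icc (0:ℝ) 1} :=
    ⟨⟨∅, MeasurableSet.empty, Set.empty_subset _⟩⟩
  refine (le_ciSup (hT' ⟨S, hS, hS1⟩) ⟨T, hT, hT1⟩).trans ?_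
  refine le_ciSup (f := fun S : {S : Set ℝ // MeasurableSet S ∧ S ⊆ Set.Icc (0:ℝ) 1} =>
    ⨆ T : {T : Set ℝ // MeasurableSet T ∧ T ⊆ Set.Icc (0:ℝ) 1},
      |∫ p in S.1 ×ˢ T.1, (f p.1 p.2 - g p.1 p.2)|) ?_ ⟨S, hS, hS1⟩
  refine ⟨1, ?_⟩
  rintro _ ⟨S, rfl⟩
  exact ciSup_le fun T => hb _ _ S.2.1 S.2.2 T.2.1 T.2.2

lemma exists_of_cutMetric_lt {f g : ℝ → ℝ → ℝ} (hf : IsGraphon f) (hg : IsGraphon g) {d : ℝ}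
    (h : cutMetric f g < d) :
    ∃ σ τ : ℝ → ℝ, IsMPB σ ∧ IsMPB τ ∧ CutLe (perm σ f) (perm τ g) d := by
  have hne : Nonempty {σ : ℝ → ℝ // IsMPB σ} := ⟨⟨_, IsMPB.id_mem⟩⟩
  unfold cutMetric at h
  obtain ⟨σ, hσ⟩ := exists_lt_of_ciInf_lt h
  obtain ⟨τ, hτ⟩ := exists_lt_of_ciInf_lt hσ
  refine ⟨σ.1, τ.1, σ.2, τ.2, fun S T hS hS1 hT hT1 => ?_⟩
  exact (CutLe.of_cutDist (hf.perm σ.2) (hg.perm τ.2) S T hS hS1 hT hT1).trans hτ.le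

/-! ### Step approximation -/

lemma clip_abs {a g : ℝ} (ha : a ∈ Set.Icc (0:ℝ) 1) : |a - max 0 (min 1 g)| ≤ |a - g| := by
  have h1 : a = max 0 (min 1 a) := by rw [min_eq_right ha.2, max_eq_right ha.1]
  calc |a - max 0 (min 1 g)| = |max 0 (min 1 a) - max 0 (min 1 g)| := by rw [← h1]
    _ ≤ |min 1 a - min 1 g| := by
        have := abs_max_sub_max_le_abs (min 1 a) (min 1 g) 0
        rwa [max_comm (min 1 a), max_comm (min 1 g)] at this
    _ ≤ |a - g| := by
        have := abs_min_sub_min_le_max 1 a 1 g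
        simpa using this

lemma step_approx {f : ℝ → ℝ → ℝ} (hf : IsGraphon f) {η : ℝ} (hη : 0 < η) :
    ∃ (m : ℕ) (r : ℝ → Fin m) (U : Fin m → Fin m → ℝ), Measurable r ∧
      (∀ i j, U i j ∈ Set.Icc (0:ℝ) 1) ∧
      ∫ p in unitSq, |f p.1 p.2 - U (r p.1) (r p.2)| ≤ η := by
  have hfi : Integrable (fun p : ℝ × ℝ => f p.1 p.2) (volume.restrict unitSq) := by
    refine Integrable.of_bound hf.meas.aestronglyMeasurable 1 (Eventually.of_forall fun p => ?_)
    have := hf.2.1 p.1 p.2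
    rw [Real.norm_eq_abs, abs_of_nonneg this.1]; exact this.2
  obtain ⟨g, hgs, hg, hgc, hgi⟩ := hfi.exists_hasCompactSupport_integral_sub_le (half_pos hη)
  have huc := hgs.uniformContinuous_of_continuous hgc
  obtain ⟨δ, hδ, hδ'⟩ := Metric.uniformContinuous_iff.1 huc (η / 2) (half_pos hη)
  obtain ⟨n, hn⟩ := exists_nat_one_div_lt hδ
  have hk : (0:ℝ) < (n:ℝ) + 1 := by positivity
  let r : ℝ → Fin (n + 2) := fun x => ⟨min ⌊((n:ℝ) + 1) * x⌋₊ (n + 1), by omega⟩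
  let c : Fin (n + 2) → ℝ := fun i => (i : ℕ) / ((n:ℝ) + 1)
  have hr : Measurable r := by
    have h1 : Measurable (fun x : ℝ => ⌊((n:ℝ) + 1) * x⌋₊) :=
      Nat.measurable_floor.comp (measurable_const.mul measurable_id)
    exact (measurable_from_top (f := fun k : ℕ => (⟨min k (n + 1), by omega⟩ : Fin (n + 2)))).comp h1
  have hc : ∀ x ∈ Set.Icc (0:ℝ) 1, dist x (c (r x)) < δ := by
    intro x hx
    have h0 : 0 ≤ ((n:ℝ) + 1) * x := mul_nonneg hk.le hx.1
    have h1 := Nat.floor_le h0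
    have h2 := Nat.lt_floor_add_one (((n:ℝ) + 1) * x)
    have h3 : ⌊((n:ℝ) + 1) * x⌋₊ ≤ n + 1 := by
      apply Nat.floor_le_of_le
      push_cast
      nlinarith [hx.2]
    have h4 : c (r x) = (⌊((n:ℝ) + 1) * x⌋₊ : ℝ) / ((n:ℝ) + 1) := by
      simp only [c, r, min_eq_left h3]
    have h5 : c (r x) ≤ x := by rw [h4, div_le_iff₀ hk]; linarith
    have h6 : x - c (r x) ≤ 1 / ((n:ℝ) + 1) := by
      rw [h4, sub_le_iff_le_add, ← add_div, le_div_iff₀ hk]; linarith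
    rw [Real.dist_eq, abs_of_nonneg (by linarith)]
    linarith
  refine ⟨n + 2, r, fun i j => max 0 (min 1 (g (c i, c j))), hr,
    fun i j => ⟨le_max_left _ _, max_le zero_le_one (min_le_left _ _)⟩, ?_⟩
  have hInt : Integrable (fun p => ‖f p.1 p.2 - g p‖ + η / 2)
      ((volume : Measure (ℝ × ℝ)).restrict unitSq) :=
    (hfi.sub hgi).norm.add (integrable_const _)
  calc ∫ p in unitSq, |f p.1 p.2 - max 0 (min 1 (g (c (r p.1), c (r p.2))))|
      ≤ ∫ p in unitSq, (‖f p.1 p.2 - g p‖ + η / 2) := by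
        refine integral_mono_of_nonneg (Eventually.of_forall fun p => abs_nonneg _) hInt ?_
        filter_upwards [ae_restrict_mem measurableSet_unitSq] with p hp
        refine (clip_abs (hf.2.1 _ _)).trans ?_
        have : dist (g p) (g (c (r p.1), c (r p.2))) < η / 2 := by
          apply hδ'
          rw [Prod.dist_eq]
          exact max_lt (hc _ hp.1) (hc _ hp.2)
        rw [Real.dist_eq] at this
        have h2 := abs_sub_le (f p.1 p.2) (g p) (g (c (r p.1), c (r p.2)))
        rw [Real.norm_eq_abs]
        linarith
    _ = (∫ p in unitSq, ‖f p.1 p.2 - g p‖) + η / 2 := by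
        have hn1 : Integrable (fun p => ‖f p.1 p.2 - g p‖)
            ((volume : Measure (ℝ × ℝ)).restrict unitSq) := (hfi.sub hgi).norm
        rw [integral_add hn1 (integrable_const _)]
        simp
    _ ≤ η := by linarith

lemma cut_step {ι : Type} [Fintype ι] [DecidableEq ι] [MeasurableSpace ι]
    [MeasurableSingletonClass ι]
    {q : ℝ → ι} (hq : Measurable q) {w : ι → ι → ℝ} {M : ℝ} (hw : ∀ i j, |w i j| ≤ M)
    {f g : ℝ → ℝ → ℝ} (hf : IsGraphon f) (hg : IsGraphon g) {d : ℝ}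
    (h : CutLe f g d) :
    |∫ p in unitSq, w (q p.1) (q p.2) * (f p.1 p.2 - g p.1 p.2)| ≤
      (Fintype.card ι : ℝ) * (Fintype.card ι : ℝ) * (M * d) := by
  let A : ι → Set ℝ := fun i => q ⁻¹' {i} ∩ Set.Icc (0:ℝ) 1
  have hA : ∀ i, MeasurableSet (A i) := fun i =>
    (hq (measurableSet_singleton i)).inter measurableSet_Icc
  have hA1 : ∀ i, A i ⊆ Set.Icc (0:ℝ) 1 := fun i => Set.inter_subset_right
  let D : ℝ × ℝ → ℝ := fun p => f p.1 p.2 - g p.1 p.2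
  have hD : Integrable D ((volume : Measure (ℝ × ℝ)).restrict unitSq) :=
    Integrable.of_bound (hf.meas.sub hg.meas).aestronglyMeasurable 1
      (Eventually.of_forall fun p => graphon_diff_abs hf hg _ _)
  have key : ∫ p in unitSq, w (q p.1) (q p.2) * (f p.1 p.2 - g p.1 p.2) =
      ∑ i, ∑ j, w i j * ∫ p in A i ×ˢ A j, D p := by
    have : ∀ p ∈ unitSq, w (q p.1) (q p.2) * (f p.1 p.2 - g p.1 p.2) =
        ∑ i, ∑ j, w i j * (A i ×ˢ A j).indicator D p := by
      intro p hp
      rw [Finset.sum_eq_single (q p.1), Finset.sum_eq_single (q p.2)]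
      · rw [Set.indicator_of_mem]
        exact ⟨⟨rfl, hp.1⟩, ⟨rfl, hp.2⟩⟩
      · intro j _ hj
        rw [Set.indicator_of_notMem, mul_zero]
        rintro ⟨_, h2⟩
        exact hj h2.1.symm
      · simp
      · intro i _ hi
        refine Finset.sum_eq_zero fun j _ => ?_
        rw [Set.indicator_of_notMem, mul_zero]
        rintro ⟨h1, _⟩
        exact hi h1.1.symm
      · simp
    have hI : ∀ i j, Integrable (fun p => w i j * (A i ×ˢ A j).indicator D p)
        ((volume : Measure (ℝ × ℝ)).restrict unitSq) := fun i j =>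
      (hD.indicator ((hA i).prod (hA j))).const_mul _
    rw [setIntegral_congr_fun measurableSet_unitSq this, integral_finsetSum]
    · refine Finset.sum_congr rfl fun i _ => ?_
      rw [integral_finsetSum _ fun j _ => hI i j]
      refine Finset.sum_congr rfl fun j _ => ?_
      rw [integral_const_mul, setIntegral_unitSq (hA i) (hA1 i) (hA j) (hA1 j)]
    · exact fun i _ => integrable_finsetSum _ fun j _ => hI i j
  rw [key]
  calc |∑ i, ∑ j, w i j * ∫ p in A i ×ˢ A j, D p|
      ≤ ∑ i, ∑ j, |w i j * ∫ p in A i ×ˢ A j, D p| :=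
        (Finset.abs_sum_le_sum_abs _ _).trans
          (Finset.sum_le_sum fun i _ => Finset.abs_sum_le_sum_abs _ _)
    _ ≤ ∑ _i : ι, ∑ _j : ι, M * d := by
        refine Finset.sum_le_sum fun i _ => Finset.sum_le_sum fun j _ => ?_
        rw [abs_mul]
        exact mul_le_mul (hw i j) (h _ _ (hA i) (hA1 i) (hA j) (hA1 j)) (abs_nonneg _)
          ((abs_nonneg _).trans (hw i j))
    _ = _ := by simp; ring

/-! ### The core estimate -/

section core
variable (lam mu t : ℝ) (hlam : 0 < lam) (hmu : 0 < mu) (ht : 0 < t)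

lemma I1W_integrable (lam mu t : ℝ) (hlam : 0 < lam) (hmu : 0 < mu) (ht : 0 < t)
    {f g : ℝ → ℝ → ℝ} (hf : IsGraphon f) (hg : IsGraphon g) :
    Integrable (fun p : ℝ × ℝ => I1 lam mu t (f p.1 p.2) (g p.1 p.2))
      (volume.restrict unitSq) := by
  obtain ⟨B, hB⟩ := I1_bdd lam mu t hlam hmu ht
  refine Integrable.of_bound (I1_measurable lam mu t hlam hmu ht hf.meas hg.meas
    (fun p => hf.2.1 _ _) (fun p => hg.2.1 _ _)).aestronglyMeasurable B
    (Eventually.of_forall fun p => ?_)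
  rw [Real.norm_eq_abs, abs_of_nonneg (I1_nonneg lam mu t hlam hmu ht (hf.2.1 _ _) (hg.2.1 _ _))]
  exact ciSup_le fun v => hB _ (hf.2.1 _ _) _ (hg.2.1 _ _) v

lemma I1W_nonneg (lam mu t : ℝ) (hlam : 0 < lam) (hmu : 0 < mu) (ht : 0 < t)
    {f g : ℝ → ℝ → ℝ} (hf : IsGraphon f) (hg : IsGraphon g) : 0 ≤ I1W lam mu t f g :=
  integral_nonneg fun p => I1_nonneg lam mu t hlam hmu ht (hf.2.1 _ _) (hg.2.1 _ _)

lemma I1W_bdd (lam mu t : ℝ) (hlam : 0 < lam) (hmu : 0 < mu) (ht : 0 < t) :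
    ∃ B : ℝ, ∀ f g : ℝ → ℝ → ℝ, IsGraphon f → IsGraphon g → I1W lam mu t f g ≤ B := by
  obtain ⟨B, hB⟩ := I1_bdd lam mu t hlam hmu ht
  refine ⟨B, fun f g hf hg => ?_⟩
  have := integral_mono (I1W_integrable lam mu t hlam hmu ht hf hg) (integrable_const B)
    (fun p => ciSup_le fun v => hB _ (hf.2.1 p.1 p.2) _ (hg.2.1 p.1 p.2) v)
  simpa [I1W] using this

lemma I1W_perm (lam mu t : ℝ) (hlam : 0 < lam) (hmu : 0 < mu) (ht : 0 < t)
    {f g : ℝ → ℝ → ℝ} (hf : IsGraphon f) (hg : IsGraphon g) {σ : ℝ → ℝ} (hσ : IsMPB σ) :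
    I1W lam mu t (perm σ f) (perm σ g) = I1W lam mu t f g :=
  integral_perm hσ (I1_measurable lam mu t hlam hmu ht hf.meas hg.meas
    (fun p => hf.2.1 _ _) (fun p => hg.2.1 _ _))

lemma core_estimate (lam mu t : ℝ) (hlam : 0 < lam) (hmu : 0 < mu) (ht : 0 < t)
    {u h : ℝ → ℝ → ℝ} (hu : IsGraphon u) (hh : IsGraphon h) {ε : ℝ} (hε : 0 < ε) :
    ∃ d : ℝ, 0 < d ∧ ∀ (u1 h1 : ℝ → ℝ → ℝ) (φ : ℝ → ℝ), IsGraphon u1 → IsGraphon h1 → IsMPB φ →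
      CutLe u1 u d → CutLe h1 (perm φ h) d →
      I1W lam mu t u (perm φ h) ≤ I1W lam mu t u1 h1 + 5 * ε := by
  obtain ⟨M, hM, hopt⟩ := near_opt lam mu t hlam hmu ht hε
  have hV : ∀ a x : ℝ, ∃ v : ℝ, |v| ≤ M ∧ (a ∈ Set.Icc (0:ℝ) 1 → x ∈ Set.Icc (0:ℝ) 1 →
      ∀ w : ℝ, w * x - Jfun lam mu t w a ≤ v * x - Jfun lam mu t v a + 2 * ε) := by
    intro a x
    by_cases hax : a ∈ Set.Icc (0:ℝ) 1 ∧ x ∈ Set.Icc (0:ℝ) 1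
    · obtain ⟨v0, hv0⟩ := exists_lt_of_lt_ciSup
        (show I1 lam mu t a x - ε < I1 lam mu t a x by linarith)
      obtain ⟨v, hv, hv1⟩ := hopt a hax.1 x hax.2 v0
      refine ⟨v, hv, fun _ _ w => ?_⟩
      linarith [le_I1 lam mu t hlam hmu ht hax.1 hax.2 w]
    · exact ⟨0, by simpa using hM.le, fun h1 h2 => absurd ⟨h1, h2⟩ hax⟩
  choose V hVM hVopt using hV
  have hη : 0 < ε / (6 * M) := by positivity
  obtain ⟨m1, r1, U1, hr1, hU1, hInt1⟩ := step_approx hu hη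
  obtain ⟨m2, r2, U2, hr2, hU2, hInt2⟩ := step_approx hh hη
  let N : ℝ := (Fintype.card (Fin m1 × Fin m2) : ℝ)
  have hN : 0 ≤ N := by positivity
  have hK : 0 < 3 * (N * N * M) + 1 := by positivity
  refine ⟨ε / (3 * (N * N * M) + 1), by positivity, ?_⟩
  intro u1 h1 φ hu1 hh1 hφ hcu hch
  set d := ε / (3 * (N * N * M) + 1) with hd
  have hdd : N * N * (M * d) + N * N * (2 * M * d) ≤ ε := by
    have : (3 * (N * N * M) + 1) * d = ε := by rw [hd]; field_simp
    have : 0 < d := by rw [hd]; positivity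
    nlinarith
  let q : ℝ → Fin m1 × Fin m2 := fun x => (r1 x, r2 (φ x))
  have hq : Measurable q := hr1.prodMk (hr2.comp hφ.1)
  let W : Fin m1 × Fin m2 → Fin m1 × Fin m2 → ℝ := fun i j => V (U1 i.1 j.1) (U2 i.2 j.2)
  let C : Fin m1 × Fin m2 → Fin m1 × Fin m2 → ℝ := fun i j => Jslope lam mu t (W i j)
  have hWb : ∀ i j, |W i j| ≤ M := fun i j => hVM _ _
  have hCb : ∀ i j, |C i j| ≤ 2 * M := fun i j => Jslope_abs lam mu t hlam hmu ht (hWb i j)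
  have hhφ := hh.perm hφ
  have cut1 := cut_step hq hWb hh1 hhφ hch
  have cut2 := cut_step hq hCb hu1 hu hcu
  have mstep : ∀ F : Fin m1 × Fin m2 → Fin m1 × Fin m2 → ℝ,
      Measurable (fun p : ℝ × ℝ => F (q p.1) (q p.2)) := fun F =>
    (Measurable.of_discrete (f := fun ij : (Fin m1 × Fin m2) × (Fin m1 × Fin m2) =>
      F ij.1 ij.2)).comp ((hq.comp measurable_fst).prodMk (hq.comp measurable_snd))
  let E1 : ℝ × ℝ → ℝ := fun p => |u p.1 p.2 - U1 (r1 p.1) (r1 p.2)|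
  let E2 : ℝ × ℝ → ℝ := fun p => |perm φ h p.1 p.2 - U2 (r2 (φ p.1)) (r2 (φ p.2))|
  let T1 : ℝ × ℝ → ℝ := fun p => W (q p.1) (q p.2) * (h1 p.1 p.2 - perm φ h p.1 p.2)
  let T2 : ℝ × ℝ → ℝ := fun p => C (q p.1) (q p.2) * (u1 p.1 p.2 - u p.1 p.2)
  have habs : ∀ a b : ℝ, a ∈ Set.Icc (0:ℝ) 1 → b ∈ Set.Icc (0:ℝ) 1 → |a - b| ≤ 1 := by
    intro a b ha hb
    rw [abs_le]; constructor <;> linarith [ha.1, ha.2, hb.1, hb.2]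
  have iE1 : Integrable E1 (volume.restrict unitSq) := by
    refine Integrable.of_bound (C := 1) ?_ (Eventually.of_forall fun p => ?_)
    · exact (hu.meas.sub (mstep fun i j => U1 i.1 j.1)).abs.aestronglyMeasurable
    · simp only [E1, Real.norm_eq_abs, abs_abs]
      exact habs _ _ (hu.2.1 _ _) (hU1 _ _)
  have iE2 : Integrable E2 (volume.restrict unitSq) := by
    refine Integrable.of_bound (C := 1) ?_ (Eventually.of_forall fun p => ?_)
    · exact (hhφ.meas.sub (mstep fun i j => U2 i.2 j.2)).abs.aestronglyMeasurable
    · simp only [E2, Real.norm_eq_abs, abs_abs]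
      exact habs _ _ (hhφ.2.1 _ _) (hU2 _ _)
  have iT1 : Integrable T1 (volume.restrict unitSq) := by
    refine Integrable.of_bound (C := M * 1) ?_ (Eventually.of_forall fun p => ?_)
    · exact ((mstep W).mul (hh1.meas.sub hhφ.meas)).aestronglyMeasurable
    · simp only [T1, Real.norm_eq_abs, abs_mul]
      exact mul_le_mul (hWb _ _) (graphon_diff_abs hh1 hhφ _ _) (abs_nonneg _) hM.le
  have iT2 : Integrable T2 (volume.restrict unitSq) := by
    refine Integrable.of_bound (C := 2 * M * 1) ?_ (Eventually.of_forall fun p => ?_)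
    · exact ((mstep C).mul (hu1.meas.sub hu.meas)).aestronglyMeasurable
    · simp only [T2, Real.norm_eq_abs, abs_mul]
      exact mul_le_mul (hCb _ _) (graphon_diff_abs hu1 hu _ _) (abs_nonneg _) (by positivity)
  have bE1 : ∫ p in unitSq, E1 p ≤ ε / (6 * M) := hInt1
  have bE2 : ∫ p in unitSq, E2 p ≤ ε / (6 * M) := by
    refine le_trans (le_of_eq ?_) hInt2
    refine integral_perm hφ (F := fun p => |h p.1 p.2 - U2 (r2 p.1) (r2 p.2)|) ?_
    exact (hh.meas.sub ((Measurable.of_discrete (f := fun ij : Fin m2 × Fin m2 =>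
      U2 ij.1 ij.2)).comp ((hr2.comp measurable_fst).prodMk (hr2.comp measurable_snd)))).abs
  have pt : ∀ p : ℝ × ℝ, I1 lam mu t (u p.1 p.2) (perm φ h p.1 p.2) ≤
      I1 lam mu t (u1 p.1 p.2) (h1 p.1 p.2) + (4 * M * E1 p + (2 * M * E2 p +
        (3 * ε + (T2 p - T1 p)))) := by
    intro p
    have ha := hu.2.1 p.1 p.2
    have hx := hhφ.2.1 p.1 p.2
    have ha0 := hU1 (r1 p.1) (r1 p.2)
    have hx0 := hU2 (r2 (φ p.1)) (r2 (φ p.2))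
    have hv := hWb (q p.1) (q p.2)
    have hvo := hVopt (U1 (r1 p.1) (r1 p.2)) (U2 (r2 (φ p.1)) (r2 (φ p.2))) ha0 hx0
    have hlow := le_I1 lam mu t hlam hmu ht (hu1.2.1 p.1 p.2) (hh1.2.1 p.1 p.2) (W (q p.1) (q p.2))
    change ∀ w : ℝ, w * U2 (r2 (φ p.1)) (r2 (φ p.2)) - Jfun lam mu t w (U1 (r1 p.1) (r1 p.2)) ≤
      W (q p.1) (q p.2) * U2 (r2 (φ p.1)) (r2 (φ p.2)) -
        Jfun lam mu t (W (q p.1) (q p.2)) (U1 (r1 p.1) (r1 p.2)) + 2 * ε at hvo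
    simp only [E1, E2, T1, T2, C]
    generalize W (q p.1) (q p.2) = v at *
    generalize U1 (r1 p.1) (r1 p.2) = a0 at *
    generalize U2 (r2 (φ p.1)) (r2 (φ p.2)) = x0 at *
    generalize u p.1 p.2 = a at *
    generalize perm φ h p.1 p.2 = x at *
    generalize u1 p.1 p.2 = a1 at *
    generalize h1 p.1 p.2 = x1 at *
    have lip : ∀ w : ℝ, |w| ≤ M → |w * (x - x0)| ≤ M * |x - x0| ∧
        |Jslope lam mu t w * (a - a0)| ≤ 2 * M * |a - a0| := by
      intro w hw
      rw [abs_mul, abs_mul]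
      exact ⟨mul_le_mul_of_nonneg_right hw (abs_nonneg _),
        mul_le_mul_of_nonneg_right (Jslope_abs lam mu t hlam hmu ht hw) (abs_nonneg _)⟩
    refine ciSup_le fun w0 => ?_
    obtain ⟨w, hw, hw1⟩ := hopt a ha x hx w0
    obtain ⟨l1, l2⟩ := lip w hw
    obtain ⟨l3, l4⟩ := lip v hv
    rw [abs_le] at l1 l2 l3 l4
    have s1 := Jfun_sub lam mu t w a a0
    have s2 := Jfun_sub lam mu t v a a0
    have s3 := Jfun_sub lam mu t v a1 a
    have := hvo w
    nlinarith [l1.1, l1.2, l2.1, l2.2, l3.1, l3.2, l4.1, l4.2]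
  have iI := I1W_integrable lam mu t hlam hmu ht hu hhφ
  have iI1 := I1W_integrable lam mu t hlam hmu ht hu1 hh1
  have i5 : Integrable (fun p => T2 p - T1 p) (volume.restrict unitSq) := iT2.sub iT1
  have i4 : Integrable (fun p => 3 * ε + (T2 p - T1 p)) (volume.restrict unitSq) :=
    (integrable_const _).add i5
  have i3 : Integrable (fun p => 2 * M * E2 p + (3 * ε + (T2 p - T1 p)))
    (volume.restrict unitSq) := (iE2.const_mul _).add i4
  have i2 : Integrable (fun p => 4 * M * E1 p + (2 * M * E2 p + (3 * ε + (T2 p - T1 p))))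
    (volume.restrict unitSq) := (iE1.const_mul _).add i3
  have main := integral_mono iI (iI1.add i2) pt
  have expand : ∫ p in unitSq, (I1 lam mu t (u1 p.1 p.2) (h1 p.1 p.2) + (4 * M * E1 p +
      (2 * M * E2 p + (3 * ε + (T2 p - T1 p))))) = I1W lam mu t u1 h1 +
      (4 * M * (∫ p in unitSq, E1 p) + (2 * M * (∫ p in unitSq, E2 p) +
      (3 * ε + ((∫ p in unitSq, T2 p) - ∫ p in unitSq, T1 p)))) := by
    rw [integral_add iI1 i2, integral_add (iE1.const_mul _) i3, integral_add (iE2.const_mul _) i4,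
      integral_add (integrable_const _) i5, integral_sub iT2 iT1, integral_const_mul,
      integral_const_mul]
    simp [I1W]
  have main2 : I1W lam mu t u (perm φ h) ≤ I1W lam mu t u1 h1 +
      (4 * M * (∫ p in unitSq, E1 p) + (2 * M * (∫ p in unitSq, E2 p) +
      (3 * ε + ((∫ p in unitSq, T2 p) - ∫ p in unitSq, T1 p)))) := by
    rw [← expand]; exact main
  have c1 := (abs_le.1 cut1).1
  have c2 := (abs_le.1 cut2).2
  change -(N * N * (M * d)) ≤ ∫ p in unitSq, T1 p at c1
  change ∫ p in unitSq, T2 p ≤ N * N * (2 * M * d) at c2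
  have e1 := mul_le_mul_of_nonneg_left bE1 (show 0 ≤ 4 * M by positivity)
  have e2 := mul_le_mul_of_nonneg_left bE2 (show 0 ≤ 2 * M by positivity)
  have e3 : 4 * M * (ε / (6 * M)) + 2 * M * (ε / (6 * M)) = ε := by field_simp; ring
  linarith

end core

lemma I1W_congr {lam mu t : ℝ} {u h h' : ℝ → ℝ → ℝ}
    (hh : ∀ x ∈ Set.Icc (0:ℝ) 1, ∀ y ∈ Set.Icc (0:ℝ) 1, h x y = h' x y) :
    I1W lam mu t u h = I1W lam mu t u h' := by
  refine setIntegral_congr_fun measurableSet_unitSq ?_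
  rintro ⟨x, y⟩ ⟨hx, hy⟩
  simp only [hh x hx y hy]

lemma CutLe.congr {f g f' g' : ℝ → ℝ → ℝ} {d : ℝ} (h : CutLe f g d)
    (hf : ∀ x ∈ Set.Icc (0:ℝ) 1, ∀ y ∈ Set.Icc (0:ℝ) 1, f x y = f' x y)
    (hg : ∀ x ∈ Set.Icc (0:ℝ) 1, ∀ y ∈ Set.Icc (0:ℝ) 1, g x y = g' x y) : CutLe f' g' d := by
  intro S T hS hS1 hT hT1
  rw [← setIntegral_congr_fun (hS.prod hT) (f := fun p : ℝ × ℝ => f p.1 p.2 - g p.1 p.2)]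
  · exact h S T hS hS1 hT hT1
  · rintro ⟨x, y⟩ ⟨hx, hy⟩
    simp only [hf x (hS1 hx) y (hT1 hy), hg x (hS1 hx) y (hT1 hy)]

/-- Lower semicontinuity of `Ĩ_{1,t}` with respect to the cut metric in both arguments. -/
theorem stmt_4 (lam mu t : ℝ) (hlam : 0 < lam) (hmu : 0 < mu) (ht : 0 < t)
    (u h : ℝ → ℝ → ℝ) (un hn : ℕ → ℝ → ℝ → ℝ)
    (hu : IsGraphon u) (hh : IsGraphon h)
    (hun : ∀ n, IsGraphon (un n)) (hhn : ∀ n, IsGraphon (hn n))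
    (hconvu : Filter.Tendsto (fun n => cutMetric (un n) u) Filter.atTop (nhds 0))
    (hconvh : Filter.Tendsto (fun n => cutMetric (hn n) h) Filter.atTop (nhds 0)) :
    I1tilde lam mu t u h ≤ Filter.atTop.liminf (fun n => I1tilde lam mu t (un n) (hn n)) := by
  have hne : Nonempty {σ : ℝ → ℝ // IsMPB σ} := ⟨⟨_, IsMPB.id_mem⟩⟩
  have hbb : ∀ f g : ℝ → ℝ → ℝ, IsGraphon f → IsGraphon g →
      BddBelow (Set.range fun σ : {σ : ℝ → ℝ // IsMPB σ} => I1W lam mu t f (perm σ.1 g)) :=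
    fun f g hf hg => ⟨0, by
      rintro _ ⟨σ, rfl⟩
      exact I1W_nonneg lam mu t hlam hmu ht hf (hg.perm σ.2)⟩
  obtain ⟨B, hB⟩ := I1W_bdd lam mu t hlam hmu ht
  refine le_of_forall_pos_le_add fun ε hε => ?_
  rw [← sub_le_iff_le_add]
  refine le_liminf_of_le ?_ ?_
  · refine isCoboundedUnder_ge_of_le (x := B) _ fun n => ?_
    exact (ciInf_le (hbb _ _ (hun n) (hhn n)) ⟨_, IsMPB.id_mem⟩).trans
      (hB _ _ (hun n) ((hhn n).perm IsMPB.id_mem))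
  obtain ⟨d, hd, hcore⟩ := core_estimate lam mu t hlam hmu ht hu hh (ε := ε / 5) (by positivity)
  filter_upwards [hconvu.eventually_lt_const hd, hconvh.eventually_lt_const hd] with n hn1 hn2
  obtain ⟨a, b, ha, hb, hab⟩ := exists_of_cutMetric_lt (hun n) hu hn1
  obtain ⟨c, e, hc, he, hce⟩ := exists_of_cutMetric_lt (hhn n) hh hn2
  obtain ⟨b', hb', hbb', hb'b⟩ := hb.exists_inv
  obtain ⟨c', hc', hcc', hc'c⟩ := hc.exists_inv
  refine le_ciInf fun σ => ?_
  obtain ⟨σ, hσ⟩ := σ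
  have hτ : IsMPB (fun x => a (b' x)) := ha.comp hb'
  have hψ : IsMPB (fun x => c' (σ (a (b' x)))) := hc'.comp (hσ.comp hτ)
  have hφ : IsMPB (fun x => e (c' (σ (a (b' x))))) := he.comp hψ
  have k1 : CutLe (perm (fun x => a (b' x)) (un n)) u d := by
    refine (hab.perm ((hun n).perm ha) (hu.perm hb) hb').congr (fun x _ y _ => rfl) ?_
    intro x hx y hy
    simp only [perm, hbb' x hx, hbb' y hy]
  have hin : ∀ x ∈ Set.Icc (0:ℝ) 1, c (c' (σ (a (b' x)))) = σ (a (b' x)) := fun x hx =>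
    hcc' _ ((hσ.comp hτ).2.1.mapsTo hx)
  have k2 : CutLe (perm (fun x => a (b' x)) (perm σ (hn n)))
      (perm (fun x => e (c' (σ (a (b' x))))) h) d := by
    refine (hce.perm ((hhn n).perm hc) (hh.perm he) hψ).congr ?_ (fun x _ y _ => rfl)
    intro x hx y hy
    simp only [perm, hin x hx, hin y hy]
  have k3 := hcore _ _ _ ((hun n).perm hτ) (((hhn n).perm hσ).perm hτ) hφ k1 k2
  rw [I1W_perm lam mu t hlam hmu ht (hun n) ((hhn n).perm hσ) hτ] at k3
  have k4 : I1tilde lam mu t u h ≤ I1W lam mu t u (perm (fun x => e (c' (σ (a (b' x))))) h) :=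
    ciInf_le (hbb _ _ hu hh) ⟨_, hφ⟩
  change I1tilde lam mu t u h - ε ≤ I1W lam mu t (un n) (perm σ (hn n))
  linarith
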